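/- Let n ≥ 1, let y_I ≥ 0 be a nonnegative real number for each nonempty subset I ⊆ [n], and let P := Σ_{nonempty I ⊆ [n]} y_I · Δ_I (Minkowski sum). Then for any pairwise distinct real numbers λ_1,…,λ_n, Vol P = (1/(n−1)!) · Σ_{w ∈ S_n} ( Σ_{nonempty I ⊆ [n]} λ_{w(min I)} · y_{w(I)} )^{n−1} / ((λ_{w(1)} − λ_{w(2)}) ⋯ (λ_{w(n−1)} − λ_{w(n)})), where min I is the least element of I and w(I) := {w(i) : i ∈ I} denotes the image of I under w. -/

import Mathlib

open MeasureTheory Pointwise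

/-- The `i`-th standard basis vector of `ℝ^n`. -/
def stdVec (n : ℕ) (i : Fin n) : Fin n → ℝ := fun j => if j = i then 1 else 0

/-- The coordinate simplex `Δ_I = ConvexHull{e_i : i ∈ I}`. -/
def coordSimplex (n : ℕ) (I : Finset (Fin n)) : Set (Fin n → ℝ) :=
  convexHull ℝ {p | ∃ i ∈ I, p = stdVec n i}

/-- Volume via projection forgetting the last coordinate. -/
noncomputable def projVol (n : ℕ) (P : Set (Fin (n + 1) → ℝ)) : ℝ :=
  (volume ((fun t : Fin (n + 1) → ℝ => fun i : Fin n => t i.castSucc) '' P)).toReal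

section

open Finset

theorem sum_div_prod_insert_zero (m : ℕ → ℝ) (n : ℕ) (hm : ∀ i ≤ n, m i ≠ 0)
    (hmm : ∀ i < n, m i - m (i + 1) ≠ 0) (A : ℕ → ℝ) :
    ∑ k ∈ range (n + 2), A k / ∏ i ∈ range (n + 1),
      ((if i < k then m i else if i = k then 0 else m (i - 1)) -
        (if i + 1 < k then m (i + 1) else if i + 1 = k then 0 else m i)) =
    (∑ k ∈ range (n + 1), (A (k + 1) - A k) / m k) / ∏ i ∈ range n, (m i - m (i + 1)) := by
  induction n with
  | zero =>
    have h0 := hm 0 le_rfl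
    simp [sum_range_succ]
    field_simp
    ring
  | succ n ih =>
    have ih := ih (fun i hi => hm i (by omega)) (fun i hi => hmm i (by omega))
    have h1 := hm n (by omega)
    have h2 := hm (n + 1) (by omega)
    have h3 := hmm n (by omega)
    have hP : ∏ i ∈ range n, (m i - m (i + 1)) ≠ 0 :=
      prod_ne_zero_iff.2 fun i hi => hmm i (by have := mem_range.1 hi; omega)
    obtain ⟨q, hq⟩ : ∃ q : ℕ → ℕ → ℝ, ∀ r k, q r k = ∏ i ∈ range r,
        ((if i < k then m i else if i = k then 0 else m (i - 1)) -
          (if i + 1 < k then m (i + 1) else if i + 1 = k then 0 else m i)) := ⟨_, fun _ _ => rfl⟩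
    simp only [← hq] at ih ⊢
    have hq_lt : ∀ r k, r < k → q r k = ∏ i ∈ range r, (m i - m (i + 1)) := by
      intro r k hr
      rw [hq]
      refine prod_congr rfl fun i hi => ?_
      have := mem_range.1 hi
      rw [if_pos (by omega), if_pos (by omega)]
    have hq_gt : ∀ k ∈ range (n + 1), A k / q (n + 1 + 1) k =
        A k / q (n + 1) k / (m n - m (n + 1)) := by
      intro k hk
      have := mem_range.1 hk
      rw [div_div, hq, prod_range_succ, ← hq, if_neg (by omega), if_neg (by omega),
        if_neg (by omega), if_neg (by omega)]
      rfl
    have hq1 : q (n + 1) (n + 1) = (∏ i ∈ range n, (m i - m (i + 1))) * m n := by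
      rw [hq, prod_range_succ, ← hq, hq_lt _ _ (by omega)]
      simp
    have hq2 : q (n + 1 + 1) (n + 1) = (∏ i ∈ range n, (m i - m (i + 1))) * m n * -m (n + 1) := by
      rw [hq, prod_range_succ, ← hq, hq1]
      simp
    have hq3 : q (n + 1 + 1) (n + 2) =
        (∏ i ∈ range n, (m i - m (i + 1))) * (m n - m (n + 1)) * m (n + 1) := by
      rw [hq, prod_range_succ, ← hq, hq_lt _ _ (by omega), prod_range_succ]
      simp
    rw [sum_range_succ, hq1] at ih
    rw [sum_range_succ, sum_range_succ, sum_congr rfl hq_gt, ← sum_div, eq_sub_of_add_eq ih,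
      hq2, hq3, prod_range_succ, sum_range_succ (n := n + 1)]
    generalize ∏ i ∈ range n, (m i - m (i + 1)) = P at *
    generalize ∑ k ∈ range (n + 1), (A (k + 1) - A k) / m k = B at *
    field_simp
    ring

theorem integral_pow_piecewise_linear (a m : ℕ → ℝ) (N r : ℕ) (D : ℝ)
    (ha : ∀ i < N, a (i + 1) ≤ a i) (hm : ∀ i < N, m i ≠ 0) (A : ℕ → ℝ)
    (hA : ∀ k ≤ N, A k = D + ∑ i ∈ range N, if k ≤ i then m i * (a (i + 1) - a i) else 0) :
    ∫ t in (a N)..(a 0), (D + ∑ i ∈ range N,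
        m i * (min 0 (a (i + 1) - t) - min 0 (a i - t))) ^ r =
      1 / (r + 1) * ∑ k ∈ range N, (A (k + 1) ^ (r + 1) - A k ^ (r + 1)) / m k := by
  have hanti : ∀ i j, i ≤ j → j ≤ N → a j ≤ a i := by
    intro i j hij
    induction j, hij using Nat.le_induction with
    | base => intro _; rfl
    | succ j hj ih => intro h; exact (ha j (by omega)).trans (ih (by omega))
  rw [intervalIntegral.integral_symm, ← intervalIntegral.sum_integral_adjacent_intervals
    (fun k _ => by apply Continuous.intervalIntegrable; fun_prop), ← sum_neg_distrib, mul_sum]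
  refine sum_congr rfl fun k hk => ?_
  have hk := mem_range.1 hk
  have hmk := hm k hk
  have hlin : Set.EqOn (fun t => (D + ∑ i ∈ range N,
        m i * (min 0 (a (i + 1) - t) - min 0 (a i - t))) ^ r)
        (fun t => (A k + m k * (a k - t)) ^ r) (Set.uIcc (a k) (a (k + 1))) := by
    intro t ht
    rw [Set.uIcc_of_ge (ha k hk)] at ht
    have : ∀ i ∈ range N, m i * (min 0 (a (i + 1) - t) - min 0 (a i - t)) =
        (if k ≤ i then m i * (a (i + 1) - a i) else 0) + if i = k then m k * (a k - t) else 0 := by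
      intro i hi
      have hi := mem_range.1 hi
      rcases lt_trichotomy i k with h | h | h
      · have h1 := hanti (i + 1) k h (by omega)
        have h2 := hanti i k (by omega) (by omega)
        rw [min_eq_left (by linarith [ht.2]), min_eq_left (by linarith [ht.2]), if_neg (by omega),
          if_neg (by omega)]
        ring
      · subst h
        rw [min_eq_right (by linarith [ht.1]), min_eq_left (by linarith [ht.2]), if_pos le_rfl,
          if_pos rfl]
        ring
      · have h1 := hanti (k + 1) i h (by omega)
        have h2 := hanti (k + 1) (i + 1) (by omega) (by omega)
        rw [min_eq_right (by linarith [ht.1]), min_eq_right (by linarith [ht.1]),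
          if_pos (by omega), if_neg (by omega)]
        ring
    simp only
    rw [sum_congr rfl this, sum_add_distrib, hA k hk.le, sum_ite_eq' , if_pos (mem_range.2 hk),
      add_assoc]
  have hstep : A (k + 1) = A k + m k * (a k - a (k + 1)) := by
    have : ∀ i ∈ range N, (if k + 1 ≤ i then m i * (a (i + 1) - a i) else 0) =
        (if k ≤ i then m i * (a (i + 1) - a i) else 0) +
          if i = k then m k * (a k - a (k + 1)) else 0 := by
      intro i _
      rcases lt_trichotomy i k with h | h | h
      · simp [show ¬ k + 1 ≤ i by omega, show ¬ k ≤ i by omega, h.ne]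
      · subst h; simp; ring
      · simp [show k + 1 ≤ i by omega, show k ≤ i by omega, h.ne']
    rw [hA k hk.le, hA (k + 1) hk, sum_congr rfl this, sum_add_distrib, sum_ite_eq',
      if_pos (mem_range.2 hk), add_assoc]
  have hr : (r + 1 : ℝ) ≠ 0 := by positivity
  rw [intervalIntegral.integral_congr hlin, intervalIntegral.integral_eq_sub_of_hasDerivAt
    (f := fun t => -(A k + m k * (a k - t)) ^ (r + 1) / ((r + 1) * m k))]
  · rw [hstep]
    simp only [sub_self, mul_zero, add_zero]
    field_simp
    ring
  · intro t _
    have h1 : HasDerivAt (fun t => A k + m k * (a k - t)) (m k * (-1)) t :=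
      (((hasDerivAt_id t).const_sub (a k)).const_mul (m k)).const_add (A k)
    refine (((h1.pow (r + 1)).neg).div_const ((r + 1) * m k)).congr_deriv ?_
    push_cast
    field_simp
  · apply Continuous.intervalIntegrable
    fun_prop

/-- The set `{w 0, …, w (k - 1)}`. -/
def firstValues {n : ℕ} (w : Equiv.Perm (Fin n)) (k : ℕ) : Finset (Fin n) :=
  (univ.filter fun j : Fin n => j.val < k).image w

/-- The value of the linear functional `lam` at the vertex of the base polytope of `f` given by `w`. -/
def vertexValue {n : ℕ} (f : Finset (Fin n) → ℝ) (lam : Fin n → ℝ) (w : Equiv.Perm (Fin n)) : ℝ :=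
  ∑ p : Fin n, lam (w p) * (f (firstValues w (p + 1)) - f (firstValues w p))

/-- The base polytope of the set function `f`. -/
def basePolytope {n : ℕ} (f : Finset (Fin n) → ℝ) : Set (Fin n → ℝ) :=
  {x | (∀ S, ∑ i ∈ S, x i ≤ f S) ∧ ∑ i, x i = f univ}

/-- The set function whose base polytope is the slice `x 0 = t` of the base polytope of `f`. -/
noncomputable def sliceFun {n : ℕ} (f : Finset (Fin (n + 1)) → ℝ) (t : ℝ) (S : Finset (Fin n)) : ℝ :=
  min (f (S.image Fin.succ)) (f (insert 0 (S.image Fin.succ)) - t)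

/-- The permutation that sends `k` to `0` and acts as `w` on the remaining positions and values. -/
def insertPerm {n : ℕ} (k : Fin (n + 1)) (w : Equiv.Perm (Fin n)) : Equiv.Perm (Fin (n + 1)) :=
  (finSuccEquiv' k).trans ((Equiv.optionCongr w).trans (finSuccEquiv' 0).symm)

theorem insertPerm_self {n : ℕ} (k : Fin (n + 1)) (w : Equiv.Perm (Fin n)) :
    insertPerm k w k = 0 := by
  simp [insertPerm]

theorem insertPerm_succAbove {n : ℕ} (k : Fin (n + 1)) (w : Equiv.Perm (Fin n)) (j : Fin n) :
    insertPerm k w (k.succAbove j) = (w j).succ := by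
  simp [insertPerm]

theorem insertPerm_symm_zero {n : ℕ} (k : Fin (n + 1)) (w : Equiv.Perm (Fin n)) :
    (insertPerm k w).symm 0 = k := by
  rw [Equiv.symm_apply_eq, insertPerm_self]

theorem insertPerm_symm_succ {n : ℕ} (k : Fin (n + 1)) (w : Equiv.Perm (Fin n)) (j : Fin n) :
    (insertPerm k w).symm j.succ = k.succAbove (w.symm j) := by
  rw [Equiv.symm_apply_eq, insertPerm_succAbove, Equiv.apply_symm_apply]

theorem insertPerm_bijective (n : ℕ) :
    Function.Bijective fun q : Fin (n + 1) × Equiv.Perm (Fin n) => insertPerm q.1 q.2 := by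
  rw [Fintype.bijective_iff_injective_and_card]
  constructor
  · rintro ⟨k, w⟩ ⟨k', w'⟩ h
    simp only at h
    have hk : k = k' := by rw [← insertPerm_symm_zero k w, h, insertPerm_symm_zero]
    subst hk
    have hw : w = w' := by
      ext j
      have := congrArg (fun σ => σ (k.succAbove j)) h
      simp only [insertPerm_succAbove] at this
      rw [Fin.succ_injective _ this]
    rw [hw]
  · simp [Fintype.card_perm, Nat.factorial_succ]

theorem mem_firstValues {n : ℕ} (w : Equiv.Perm (Fin n)) (k : ℕ) (x : Fin n) :
    x ∈ firstValues w k ↔ (w.symm x).val < k := by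
  simp only [firstValues, mem_image, mem_filter, mem_univ, true_and]
  exact ⟨by rintro ⟨j, hj, rfl⟩; simpa using hj, fun h => ⟨w.symm x, h, by simp⟩⟩

theorem firstValues_zero {n : ℕ} (w : Equiv.Perm (Fin n)) : firstValues w 0 = ∅ := by
  ext x; simp [mem_firstValues]

theorem firstValues_of_le {n : ℕ} (w : Equiv.Perm (Fin n)) {k : ℕ} (hk : n ≤ k) :
    firstValues w k = univ := by
  ext x
  simp only [mem_firstValues, mem_univ, iff_true]
  exact (w.symm x).isLt.trans_le hk

theorem val_succAbove {n : ℕ} (k : Fin (n + 1)) (j : Fin n) :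
    (k.succAbove j).val = if j.val < k.val then j.val else j.val + 1 := by
  unfold Fin.succAbove
  simp only [Fin.lt_def, Fin.val_castSucc]
  split_ifs <;> simp

theorem firstValues_insertPerm_of_le {n : ℕ} (k : Fin (n + 1)) (w : Equiv.Perm (Fin n)) {q : ℕ}
    (hq : q ≤ k) : firstValues (insertPerm k w) q = (firstValues w q).image Fin.succ := by
  ext x
  refine Fin.cases ?_ (fun x => ?_) x
  · simpa [mem_firstValues, insertPerm_symm_zero] using hq
  · rw [mem_firstValues, insertPerm_symm_succ, val_succAbove, Fin.succ_injective _ |>.mem_finset_image,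
      mem_firstValues]
    split_ifs <;> omega

theorem firstValues_insertPerm_of_lt {n : ℕ} (k : Fin (n + 1)) (w : Equiv.Perm (Fin n)) {q : ℕ}
    (hq : k ≤ q) : firstValues (insertPerm k w) (q + 1) =
      insert 0 ((firstValues w q).image Fin.succ) := by
  ext x
  refine Fin.cases ?_ (fun x => ?_) x
  · simpa [mem_firstValues, insertPerm_symm_zero, Nat.lt_succ_iff] using hq
  · rw [mem_firstValues, insertPerm_symm_succ, val_succAbove, mem_insert,
      Fin.succ_injective _ |>.mem_finset_image, mem_firstValues]
    simp only [Fin.succ_ne_zero, false_or]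
    split_ifs <;> omega

theorem sum_range_ite_sub (φ ψ : ℕ → ℝ) (k N : ℕ) (hk : k ≤ N) :
    ∑ j ∈ range N, (if k ≤ j then ψ (j + 1) - ψ j else φ (j + 1) - φ j) =
      ψ N - (ψ k - φ k) - φ 0 := by
  induction N, hk using Nat.le_induction with
  | base =>
    rw [sum_congr rfl fun j hj => if_neg (by have := mem_range.1 hj; omega), sum_range_sub]
    ring
  | succ N hN ih =>
    rw [sum_range_succ, ih, if_pos hN]
    ring

theorem integral_vertexValue_sliceFun {n : ℕ} (f : Finset (Fin (n + 2)) → ℝ) (hf0 : f ∅ = 0)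
    (hf : ∀ S T, f (S ∩ T) + f (S ∪ T) ≤ f S + f T) (lam : Fin (n + 2) → ℝ)
    (hlam : Function.Injective lam) (c : ℝ) (w : Equiv.Perm (Fin (n + 1))) :
    ∫ t in (f univ - f (univ.image Fin.succ))..(f {0}),
      (vertexValue (sliceFun f t) (fun i => lam i.succ - lam 0) w + (c + lam 0 * f univ)) ^ n /
        ∏ i : Fin n, ((lam (w i.castSucc).succ - lam 0) - (lam (w i.succ).succ - lam 0)) =
    1 / (n + 1) * ∑ k : Fin (n + 2), (vertexValue f lam (insertPerm k w) + c) ^ (n + 1) /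
      ∏ i : Fin (n + 1), (lam (insertPerm k w i.castSucc) - lam (insertPerm k w i.succ)) := by
  obtain ⟨m, hm⟩ : ∃ m : ℕ → ℝ, ∀ i : Fin (n + 1), m i = lam (w i).succ - lam 0 :=
    ⟨fun i => if h : i < n + 1 then lam (w ⟨i, h⟩).succ - lam 0 else 0, fun i => dif_pos i.isLt⟩
  obtain ⟨φ, hφ⟩ : ∃ φ : ℕ → ℝ, ∀ k, f ((firstValues w k).image Fin.succ) = φ k :=
    ⟨_, fun _ => rfl⟩
  obtain ⟨ψ, hψ⟩ : ∃ ψ : ℕ → ℝ, ∀ k, f (insert 0 ((firstValues w k).image Fin.succ)) = ψ k :=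
    ⟨_, fun _ => rfl⟩
  have huniv : (insert 0 ((univ : Finset (Fin (n + 1))).image Fin.succ)) = univ := by
    ext x
    refine Fin.cases ?_ (fun x => ?_) x <;> simp
  have hφN : φ (n + 1) = f (univ.image Fin.succ) := by rw [← hφ, firstValues_of_le w le_rfl]
  have hψN : ψ (n + 1) = f univ := by rw [← hψ, firstValues_of_le w le_rfl, huniv]
  have hφ0 : φ 0 = 0 := by rw [← hφ, firstValues_zero, image_empty, hf0]
  have hψ0 : ψ 0 = f {0} := by rw [← hψ, firstValues_zero, image_empty]; rfl
  have hanti : ∀ i < n + 1, ψ (i + 1) - φ (i + 1) ≤ ψ i - φ i := by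
    intro i _
    have hsub : firstValues w i ⊆ firstValues w (i + 1) := fun x => by
      simp only [mem_firstValues]; omega
    have h := hf (insert 0 ((firstValues w i).image Fin.succ)) ((firstValues w (i + 1)).image Fin.succ)
    have h1 : insert 0 ((firstValues w i).image Fin.succ) ∩ ((firstValues w (i + 1)).image Fin.succ) =
        (firstValues w i).image Fin.succ := by
      rw [insert_inter_of_notMem (by simp), inter_eq_left]
      exact image_subset_image hsub
    have h2 : insert 0 ((firstValues w i).image Fin.succ) ∪ ((firstValues w (i + 1)).image Fin.succ) =
        insert 0 ((firstValues w (i + 1)).image Fin.succ) := by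
      rw [insert_union, union_eq_right.2 (image_subset_image hsub)]
    rw [h1, h2, hφ, hφ, hψ, hψ] at h
    linarith
  have hm0 : ∀ i ≤ n, m i ≠ 0 := by
    intro i hi
    rw [show i = (⟨i, by omega⟩ : Fin (n + 1)).val from rfl, hm, sub_ne_zero]
    exact fun h => Fin.succ_ne_zero _ (hlam h)
  have hmm : ∀ i < n, m i - m (i + 1) ≠ 0 := by
    intro i hi
    rw [show i = (⟨i, by omega⟩ : Fin (n + 1)).val from rfl, hm,
      show (⟨i, by omega⟩ : Fin (n + 1)).val + 1 = (⟨i + 1, by omega⟩ : Fin (n + 1)).val from rfl, hm,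
      sub_sub_sub_cancel_right, sub_ne_zero]
    intro h
    have := w.injective (Fin.succ_injective _ (hlam h))
    simp at this
  have hval : ∀ t, vertexValue (sliceFun f t) (fun i => lam i.succ - lam 0) w +
      (c + lam 0 * f univ) =
      (∑ i ∈ range (n + 1), m i * (φ (i + 1) - φ i) + (c + lam 0 * f univ)) +
      ∑ i ∈ range (n + 1), m i * (min 0 ((ψ (i + 1) - φ (i + 1)) - t) - min 0 ((ψ i - φ i) - t)) := by
    intro t
    have hs : ∀ k, sliceFun f t (firstValues w k) = φ k + min 0 ((ψ k - φ k) - t) := by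
      intro k
      rw [sliceFun, hφ, hψ, ← min_add_add_left]
      congr 1 <;> ring
    simp only [vertexValue, hs, ← hm]
    rw [Fin.sum_univ_eq_sum_range (fun i => m i * (φ (i + 1) + min 0 (ψ (i + 1) - φ (i + 1) - t) -
      (φ i + min 0 (ψ i - φ i - t)))), add_right_comm, ← sum_add_distrib]
    congr 1
    exact sum_congr rfl fun i _ => by ring
  have hins : ∀ k : Fin (n + 2), vertexValue f lam (insertPerm k w) + c =
      (∑ i ∈ range (n + 1), m i * (φ (i + 1) - φ i) + (c + lam 0 * f univ)) +
      ∑ i ∈ range (n + 1), if k.val ≤ i then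
        m i * ((ψ (i + 1) - φ (i + 1)) - (ψ i - φ i)) else 0 := by
    intro k
    have hj : ∀ j : Fin (n + 1), lam (insertPerm k w (k.succAbove j)) *
        (f (firstValues (insertPerm k w) ((k.succAbove j).val + 1)) -
          f (firstValues (insertPerm k w) (k.succAbove j).val)) =
        (m j + lam 0) * (if k.val ≤ j.val then ψ (j + 1) - ψ j else φ (j + 1) - φ j) := by
      intro j
      rw [insertPerm_succAbove, hm, sub_add_cancel, val_succAbove]
      split_ifs with h1 h2 h2
      · omega
      · rw [firstValues_insertPerm_of_le k w (by omega), firstValues_insertPerm_of_le k w (by omega),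
          hφ, hφ]
      · rw [firstValues_insertPerm_of_lt k w (by omega), firstValues_insertPerm_of_lt k w (by omega),
          hψ, hψ]
      · omega
    rw [vertexValue, Fin.sum_univ_succAbove _ k, sum_congr rfl fun j _ => hj j, insertPerm_self,
      firstValues_insertPerm_of_le k w le_rfl, firstValues_insertPerm_of_lt k w le_rfl, hφ, hψ,
      Fin.sum_univ_eq_sum_range (fun j => (m j + lam 0) *
        (if k.val ≤ j then ψ (j + 1) - ψ j else φ (j + 1) - φ j))]
    simp only [add_mul]
    rw [sum_add_distrib, ← mul_sum, sum_range_ite_sub φ ψ k (n + 1) (by omega), hφ0, hψN]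
    have : ∀ i ∈ range (n + 1),
        m i * (if k.val ≤ i then ψ (i + 1) - ψ i else φ (i + 1) - φ i) = m i * (φ (i + 1) - φ i) +
        if k.val ≤ i then m i * ((ψ (i + 1) - φ (i + 1)) - (ψ i - φ i)) else 0 := by
      intro i _
      split_ifs <;> ring
    rw [sum_congr rfl this, sum_add_distrib]
    ring
  obtain ⟨A, hA⟩ : ∃ A : ℕ → ℝ, ∀ k : ℕ, A k =
      (∑ i ∈ range (n + 1), m i * (φ (i + 1) - φ i) + (c + lam 0 * f univ)) +
      ∑ i ∈ range (n + 1), if k ≤ i then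
        m i * ((ψ (i + 1) - φ (i + 1)) - (ψ i - φ i)) else 0 := ⟨_, fun _ => rfl⟩
  have hx : ∀ k i : Fin (n + 2), lam (insertPerm k w i) - lam 0 =
      if i.val < k.val then m i else if i.val = k.val then 0 else m (i - 1) := by
    intro k i
    rcases Fin.eq_self_or_eq_succAbove k i with rfl | ⟨j, rfl⟩
    · simp [insertPerm_self]
    · rw [insertPerm_succAbove, ← hm, val_succAbove]
      split_ifs <;> first | omega | rfl
  have hprod : ∀ k : Fin (n + 2),
      ∏ i : Fin (n + 1), (lam (insertPerm k w i.castSucc) - lam (insertPerm k w i.succ)) =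
      ∏ i ∈ range (n + 1), ((if i < k.val then m i else if i = k.val then 0 else m (i - 1)) -
        (if i + 1 < k.val then m (i + 1) else if i + 1 = k.val then 0 else m i)) := by
    intro k
    rw [← Fin.prod_univ_eq_prod_range (fun i =>
      ((if i < k.val then m i else if i = k.val then 0 else m (i - 1)) -
        (if i + 1 < k.val then m (i + 1) else if i + 1 = k.val then 0 else m i)))]
    refine prod_congr rfl fun i _ => ?_
    rw [← sub_sub_sub_cancel_right _ _ (lam 0), hx, hx]
    simp
  have hprod' : ∏ i : Fin n, ((lam (w i.castSucc).succ - lam 0) - (lam (w i.succ).succ - lam 0)) =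
      ∏ i ∈ range n, (m i - m (i + 1)) := by
    rw [← Fin.prod_univ_eq_prod_range (fun i => m i - m (i + 1))]
    refine prod_congr rfl fun i _ => ?_
    rw [← hm, ← hm]
    simp
  simp only [hval, hins, ← hA, hprod, hprod']
  have hψφ0 : f {0} = ψ 0 - φ 0 := by rw [hφ0, hψ0, sub_zero]
  rw [intervalIntegral.integral_div, ← hψN, ← hφN, hψφ0,
    integral_pow_piecewise_linear (fun k => ψ k - φ k) m (n + 1) n _ hanti
      (fun i hi => hm0 i (by omega)) A (fun k _ => by rw [hA, hψN]),
    Fin.sum_univ_eq_sum_range (fun k => A k ^ (n + 1) / ∏ i ∈ range (n + 1),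
      ((if i < k then m i else if i = k then 0 else m (i - 1)) -
        (if i + 1 < k then m (i + 1) else if i + 1 = k then 0 else m i))),
    sum_div_prod_insert_zero m n hm0 hmm (fun k => A k ^ (n + 1)), mul_div_assoc]

theorem isCompact_basePolytope {n : ℕ} (f : Finset (Fin n) → ℝ) : IsCompact (basePolytope f) := by
  have hclosed : IsClosed (basePolytope f) := by
    have : basePolytope f = (⋂ S, {x : Fin n → ℝ | ∑ i ∈ S, x i ≤ f S}) ∩ {x | ∑ i, x i = f univ} := by
      ext x; simp [basePolytope]
    rw [this]
    refine (isClosed_iInter fun S => ?_).inter ?_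
    · exact isClosed_le (by fun_prop) continuous_const
    · exact isClosed_eq (by fun_prop) continuous_const
  refine (isCompact_Icc (a := fun i => f univ - f (univ.erase i)) (b := fun i => f {i})).of_isClosed_subset
    hclosed fun x hx => ⟨fun i => ?_, fun i => ?_⟩
  · have h1 := hx.1 (univ.erase i)
    have h2 := hx.2
    rw [← add_sum_erase _ _ (mem_univ i)] at h2
    simp only
    linarith
  · simpa using hx.1 {i}

theorem cons_mem_basePolytope_iff {n : ℕ} (f : Finset (Fin (n + 1)) → ℝ) (t : ℝ)
    (ht : f univ - f (univ.image Fin.succ) ≤ t) (z : Fin n → ℝ) :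
    (Fin.cons t z : Fin (n + 1) → ℝ) ∈ basePolytope f ↔ z ∈ basePolytope (sliceFun f t) := by
  have hsucc : ∀ S : Finset (Fin n),
      ∑ i ∈ S.image Fin.succ, (Fin.cons t z : Fin (n + 1) → ℝ) i = ∑ i ∈ S, z i := by
    intro S
    rw [sum_image (Fin.succ_injective _).injOn]
    simp
  have hins : ∀ S : Finset (Fin n),
      ∑ i ∈ insert 0 (S.image Fin.succ), (Fin.cons t z : Fin (n + 1) → ℝ) i = t + ∑ i ∈ S, z i := by
    intro S
    rw [sum_insert (by simp), hsucc]
    simp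
  have huniv : (insert 0 ((univ : Finset (Fin n)).image Fin.succ)) = univ := by
    ext x
    refine Fin.cases ?_ (fun x => ?_) x <;> simp
  have htot : sliceFun f t univ = f univ - t := by
    rw [sliceFun, huniv]
    exact min_eq_right (by linarith)
  have hall : (∀ S, ∑ i ∈ S, (Fin.cons t z : Fin (n + 1) → ℝ) i ≤ f S) ↔
      ∀ S : Finset (Fin n), ∑ i ∈ S, z i ≤ sliceFun f t S := by
    constructor
    · intro h S
      have h1 := h (S.image Fin.succ)
      have h2 := h (insert 0 (S.image Fin.succ))
      rw [hsucc] at h1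
      rw [hins] at h2
      exact le_min h1 (by linarith)
    · intro h S
      have hS := le_min_iff.1 (h (univ.filter fun j => j.succ ∈ S))
      by_cases h0 : (0 : Fin (n + 1)) ∈ S
      · have : insert 0 ((univ.filter fun j : Fin n => j.succ ∈ S).image Fin.succ) = S := by
          ext x
          refine Fin.cases ?_ (fun x => ?_) x <;> simp [h0]
        rw [← this, hins, this]
        rw [this] at hS
        linarith [hS.2]
      · have : ((univ.filter fun j : Fin n => j.succ ∈ S).image Fin.succ) = S := by
          ext x
          refine Fin.cases ?_ (fun x => ?_) x <;> simp [h0]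
        rw [← this, hsucc, this]
        rw [this] at hS
        exact hS.1
  simp only [basePolytope, Set.mem_ofPred_eq, hall, htot, Fin.sum_univ_succ, Fin.cons_zero,
    Fin.cons_succ]
  exact and_congr_right fun _ => ⟨fun h => by linarith, fun h => by linarith⟩

theorem zero_mem_Icc_of_mem_basePolytope {n : ℕ} (f : Finset (Fin (n + 1)) → ℝ)
    {x : Fin (n + 1) → ℝ} (hx : x ∈ basePolytope f) :
    x 0 ∈ Set.Icc (f univ - f (univ.image Fin.succ)) (f {0}) := by
  have h1 := hx.1 (univ.image Fin.succ)
  have h2 := hx.2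
  rw [sum_image (Fin.succ_injective _).injOn] at h1
  rw [Fin.sum_univ_succ] at h2
  exact ⟨by linarith, by simpa using hx.1 {0}⟩

theorem sliceFun_empty {n : ℕ} (f : Finset (Fin (n + 1)) → ℝ) (hf0 : f ∅ = 0) {t : ℝ}
    (ht : t ≤ f {0}) : sliceFun f t ∅ = 0 := by
  rw [sliceFun, image_empty, hf0]
  exact min_eq_left (sub_nonneg.2 ht)

theorem sliceFun_submodular {n : ℕ} (f : Finset (Fin (n + 1)) → ℝ)
    (hf : ∀ S T, f (S ∩ T) + f (S ∪ T) ≤ f S + f T) (t : ℝ) (S T : Finset (Fin n)) :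
    sliceFun f t (S ∩ T) + sliceFun f t (S ∪ T) ≤ sliceFun f t S + sliceFun f t T := by
  have h1 := hf (S.image Fin.succ) (T.image Fin.succ)
  have h2 := hf (insert 0 (S.image Fin.succ)) (insert 0 (T.image Fin.succ))
  have h3 := hf (insert 0 (S.image Fin.succ)) (T.image Fin.succ)
  have h4 := hf (S.image Fin.succ) (insert 0 (T.image Fin.succ))
  rw [← image_inter _ _ (Fin.succ_injective _), ← image_union] at h1
  rw [← insert_inter_distrib, ← insert_union_distrib, ← image_inter _ _ (Fin.succ_injective _),
    ← image_union] at h2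
  rw [insert_inter_of_notMem (by simp), insert_union, ← image_inter _ _ (Fin.succ_injective _),
    ← image_union] at h3
  rw [inter_insert_of_notMem (by simp), union_insert, ← image_inter _ _ (Fin.succ_injective _),
    ← image_union] at h4
  simp only [sliceFun]
  have a1 := min_le_left (f ((S ∩ T).image Fin.succ)) (f (insert 0 ((S ∩ T).image Fin.succ)) - t)
  have a2 := min_le_right (f ((S ∩ T).image Fin.succ)) (f (insert 0 ((S ∩ T).image Fin.succ)) - t)
  have b1 := min_le_left (f ((S ∪ T).image Fin.succ)) (f (insert 0 ((S ∪ T).image Fin.succ)) - t)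
  have b2 := min_le_right (f ((S ∪ T).image Fin.succ)) (f (insert 0 ((S ∪ T).image Fin.succ)) - t)
  rcases min_choice (f (S.image Fin.succ)) (f (insert 0 (S.image Fin.succ)) - t) with h | h <;>
  rcases min_choice (f (T.image Fin.succ)) (f (insert 0 (T.image Fin.succ)) - t) with h' | h' <;>
  rw [h, h'] <;> linarith

theorem continuous_vertexValue_sliceFun {n : ℕ} (f : Finset (Fin (n + 1)) → ℝ) (lam : Fin n → ℝ)
    (w : Equiv.Perm (Fin n)) : Continuous fun t => vertexValue (sliceFun f t) lam w := by
  unfold vertexValue sliceFun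
  fun_prop

theorem volume_real_eq_integral_cons {n : ℕ} {Q : Set (Fin (n + 1) → ℝ)} (hQ : IsCompact Q) :
    (volume Q).toReal = ∫ t, (volume {z : Fin n → ℝ | (Fin.cons t z : Fin (n + 1) → ℝ) ∈ Q}).toReal := by
  have hmp := (volume_preserving_piFinSuccAbove (fun _ : Fin (n + 1) => ℝ) 0).symm
  have hmeas : MeasurableSet ((MeasurableEquiv.piFinSuccAbove (fun _ : Fin (n + 1) => ℝ) 0).symm ⁻¹' Q) :=
    hmp.measurable hQ.measurableSet
  have hvol := hmp.measure_preimage_equiv Q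
  rw [Measure.volume_eq_prod, Measure.prod_apply hmeas] at hvol
  have hslice : ∀ t : ℝ, (Prod.mk t ⁻¹'
      ((MeasurableEquiv.piFinSuccAbove (fun _ : Fin (n + 1) => ℝ) 0).symm ⁻¹' Q)) =
      {z : Fin n → ℝ | (Fin.cons t z : Fin (n + 1) → ℝ) ∈ Q} := by
    intro t
    ext z
    simp [MeasurableEquiv.piFinSuccAbove, Fin.insertNthEquiv]
  have hmf := measurable_measure_prodMk_left (ν := (volume : Measure (Fin n → ℝ))) hmeas
  simp only [hslice] at hvol hmf
  rw [integral_toReal hmf.aemeasurable, hvol]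
  refine ae_lt_top hmf ?_
  rw [hvol]
  exact hQ.measure_lt_top.ne

theorem projVol_basePolytope (n : ℕ) (f : Finset (Fin (n + 1)) → ℝ) (hf0 : f ∅ = 0)
    (hf : ∀ S T, f (S ∩ T) + f (S ∪ T) ≤ f S + f T) (lam : Fin (n + 1) → ℝ)
    (hlam : Function.Injective lam) (c : ℝ) :
    projVol n (basePolytope f) = (1 / (Nat.factorial n : ℝ)) *
      ∑ w : Equiv.Perm (Fin (n + 1)), (vertexValue f lam w + c) ^ n /
        ∏ i : Fin n, (lam (w i.castSucc) - lam (w i.succ)) := by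
  induction n generalizing c with
  | zero =>
    have hne : (fun _ => f {0} : Fin 1 → ℝ) ∈ basePolytope f := by
      refine ⟨fun S => ?_, by simp⟩
      rcases S.eq_empty_or_nonempty with rfl | ⟨x, hx⟩
      · simp [hf0]
      · have : S = {0} := by
          ext y
          rw [Fin.fin_one_eq_zero x] at hx
          rw [Fin.fin_one_eq_zero y]
          simpa using hx
        simp [this]
    have : (fun t : Fin 1 → ℝ => fun i : Fin 0 => t i.castSucc) '' basePolytope f = Set.univ :=
      Set.eq_univ_of_forall fun z => ⟨_, hne, Subsingleton.elim _ _⟩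
    simp [projVol, this, volume_pi]
  | succ n ih =>
    have hcomp : IsCompact ((fun t : Fin (n + 2) → ℝ => fun i : Fin (n + 1) => t i.castSucc) ''
        basePolytope f) := (isCompact_basePolytope f).image (by fun_prop)
    have hle : f univ - f (univ.image Fin.succ) ≤ f {0} := by
      have h := hf (univ.image Fin.succ) {0}
      rw [inter_singleton_of_notMem (by simp), hf0, union_comm, ← insert_eq] at h
      have huniv : (insert 0 ((univ : Finset (Fin (n + 1))).image Fin.succ)) = univ := by
        ext x
        refine Fin.cases ?_ (fun x => ?_) x <;> simp
      rw [huniv] at h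
      linarith
    have hslice : ∀ t, (volume {z : Fin n → ℝ | (Fin.cons t z : Fin (n + 1) → ℝ) ∈
        (fun t : Fin (n + 2) → ℝ => fun i : Fin (n + 1) => t i.castSucc) '' basePolytope f}).toReal =
        (Set.Icc (f univ - f (univ.image Fin.succ)) (f {0})).indicator
          (fun t => projVol n (basePolytope (sliceFun f t))) t := by
      intro t
      have hmem : ∀ z : Fin n → ℝ, (Fin.cons t z : Fin (n + 1) → ℝ) ∈
          (fun t : Fin (n + 2) → ℝ => fun i : Fin (n + 1) => t i.castSucc) '' basePolytope f ↔
          ∃ x : Fin (n + 1) → ℝ, (Fin.cons t x : Fin (n + 2) → ℝ) ∈ basePolytope f ∧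
            (fun i : Fin n => x i.castSucc) = z := by
        intro z
        constructor
        · rintro ⟨x, hx, hxz⟩
          have h0 : x 0 = t := by simpa using congrFun hxz 0
          refine ⟨Fin.tail x, by rwa [← h0, Fin.cons_self_tail], ?_⟩
          ext i
          simpa [Fin.tail] using congrFun hxz i.succ
        · rintro ⟨x, hx, rfl⟩
          refine ⟨_, hx, ?_⟩
          ext i
          refine Fin.cases ?_ (fun i => ?_) i <;> simp
      by_cases ht : t ∈ Set.Icc (f univ - f (univ.image Fin.succ)) (f {0})
      · rw [Set.indicator_of_mem ht, projVol]
        congr 2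
        ext z
        rw [Set.mem_ofPred_eq, hmem]
        simp only [cons_mem_basePolytope_iff f t ht.1, Set.mem_image]
      · rw [Set.indicator_of_notMem ht]
        have : {z : Fin n → ℝ | (Fin.cons t z : Fin (n + 1) → ℝ) ∈
          (fun t : Fin (n + 2) → ℝ => fun i : Fin (n + 1) => t i.castSucc) '' basePolytope f} = ∅ := by
          ext z
          simp only [Set.mem_ofPred_eq, hmem, Set.mem_empty_iff_false, iff_false]
          rintro ⟨x, hx, -⟩
          exact ht (by simpa using zero_mem_Icc_of_mem_basePolytope f hx)
        rw [this]
        simp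
    have hlam' : Function.Injective fun i : Fin (n + 1) => lam i.succ - lam 0 := fun i j h =>
      Fin.succ_injective _ (hlam (sub_left_injective h))
    rw [projVol, volume_real_eq_integral_cons hcomp]
    simp only [hslice]
    rw [integral_indicator measurableSet_Icc, setIntegral_congr_fun measurableSet_Icc fun t ht =>
      ih (sliceFun f t) (sliceFun_empty f hf0 ht.2) (sliceFun_submodular f hf t) _ hlam'
        (c + lam 0 * f univ), integral_Icc_eq_integral_Ioc,
      ← intervalIntegral.integral_of_le hle, intervalIntegral.integral_const_mul,
      intervalIntegral.integral_finsetSum, sum_congr rfl fun w _ =>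
        integral_vertexValue_sliceFun f hf0 hf lam hlam c w, ← mul_sum, ← mul_assoc]
    · congr 1
      · rw [Nat.factorial_succ]
        push_cast
        rw [div_mul_div_comm, one_mul, mul_comm (n + 1 : ℝ)]
      · rw [sum_comm, ← Fintype.sum_prod_type']
        exact (insertPerm_bijective (n + 1)).sum_comp (fun σ : Equiv.Perm (Fin (n + 2)) =>
          (vertexValue f lam σ + c) ^ (n + 1) /
          ∏ i : Fin (n + 1), (lam (σ i.castSucc) - lam (σ i.succ)))
    · intro w _
      apply Continuous.intervalIntegrable
      have := continuous_vertexValue_sliceFun f (fun i => lam i.succ - lam 0) w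
      fun_prop

/-- The support function `S ↦ ∑ y_I` over the `I` that meet `S`. -/
noncomputable def meetSum {n : ℕ} (y : Finset (Fin n) → ℝ) (S : Finset (Fin n)) : ℝ :=
  ∑ I, if (I ∩ S).Nonempty then y I else 0

theorem meetSum_empty {n : ℕ} (y : Finset (Fin n) → ℝ) : meetSum y ∅ = 0 := by
  simp [meetSum]

theorem meetSum_univ {n : ℕ} (y : Finset (Fin n) → ℝ) :
    meetSum y univ = ∑ I ∈ univ.filter (fun I : Finset (Fin n) => I.Nonempty), y I := by
  simp [meetSum, sum_filter]

theorem meetSum_submodular {n : ℕ} (y : Finset (Fin n) → ℝ) (hy : ∀ I, 0 ≤ y I)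
    (S T : Finset (Fin n)) :
    meetSum y (S ∩ T) + meetSum y (S ∪ T) ≤ meetSum y S + meetSum y T := by
  simp only [meetSum, ← sum_add_distrib]
  refine sum_le_sum fun I _ => ?_
  have h := hy I
  have h1 : (I ∩ (S ∪ T)).Nonempty ↔ (I ∩ S).Nonempty ∨ (I ∩ T).Nonempty := by
    rw [inter_union_distrib_left, union_nonempty]
  have h2 : (I ∩ (S ∩ T)).Nonempty → (I ∩ S).Nonempty ∧ (I ∩ T).Nonempty := fun h =>
    ⟨h.mono (inter_subset_inter_left inter_subset_left),
      h.mono (inter_subset_inter_left inter_subset_right)⟩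
  by_cases hS : (I ∩ S).Nonempty <;> by_cases hT : (I ∩ T).Nonempty <;>
    by_cases hST : (I ∩ (S ∩ T)).Nonempty <;> simp_all

theorem integral_indicator_lt (M c : ℝ) (h1 : -M ≤ c) (h2 : c ≤ M) :
    ∫ s in (-M)..M, (if s < c then (1 : ℝ) else 0) = c + M := by
  have : (fun s => if s < c then (1 : ℝ) else 0) = (Set.Iio c).indicator 1 := by
    ext s; simp [Set.indicator_apply]
  rw [this, intervalIntegral.integral_of_le (h1.trans h2), integral_indicator_one measurableSet_Iio,
    measureReal_restrict_apply measurableSet_Iio]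
  have : Set.Iio c ∩ Set.Ioc (-M) M = Set.Ioo (-M) c := by
    ext s
    simp only [Set.mem_inter_iff, Set.mem_Iio, Set.mem_Ioc, Set.mem_Ioo]
    exact ⟨fun h => ⟨h.2.1, h.1⟩, fun h => ⟨h.2, h.1, h.2.le.trans h2⟩⟩
  rw [this, Real.volume_real_Ioo_of_le h1]
  ring

theorem intervalIntegrable_indicator_lt (a b c : ℝ) :
    IntervalIntegrable (fun s => if s < c then (1 : ℝ) else 0) volume a b := by
  have : (fun s => if s < c then (1 : ℝ) else 0) = (Set.Iio c).indicator fun _ => 1 := by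
    ext s; simp [Set.indicator_apply]
  rw [this, intervalIntegrable_iff]
  exact (intervalIntegrable_iff.1 intervalIntegrable_const).indicator measurableSet_Iio

theorem sum_mul_le_of_mem_basePolytope {n : ℕ} (y : Finset (Fin n) → ℝ)
    {x : Fin n → ℝ} (hx : x ∈ basePolytope (meetSum y)) (c : Fin n → ℝ)
    (j : Finset (Fin n) → Fin n) (hj : ∀ I, I.Nonempty → j I ∈ I ∧ ∀ i ∈ I, c i ≤ c (j I)) :
    ∑ i, x i * c i ≤ ∑ I ∈ univ.filter (fun I : Finset (Fin n) => I.Nonempty), y I * c (j I) := by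
  obtain ⟨M, hM⟩ : ∃ M, ∀ i, |c i| ≤ M := by
    obtain ⟨M, hM⟩ := (Set.finite_range fun i => |c i|).bddAbove
    exact ⟨M, fun i => hM ⟨i, rfl⟩⟩
  have hcM : ∀ i, c i = (∫ s in (-M)..M, (if s < c i then (1 : ℝ) else 0)) - M := fun i => by
    rw [integral_indicator_lt M (c i) (abs_le.1 (hM i)).1 (abs_le.1 (hM i)).2, add_sub_cancel_right]
  have hsum : ∀ {ι : Type} (s : Finset ι) (v : ι → ℝ) (k : ι → Fin n), ∑ i ∈ s, v i * c (k i) =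
      (∫ t in (-M)..M, ∑ i ∈ s, v i * (if t < c (k i) then (1 : ℝ) else 0)) -
        (∑ i ∈ s, v i) * M := by
    intro ι s v k
    rw [intervalIntegral.integral_finsetSum fun i _ =>
      (intervalIntegrable_indicator_lt _ _ _).const_mul _, sum_mul, ← sum_sub_distrib]
    refine sum_congr rfl fun i _ => ?_
    rw [intervalIntegral.integral_const_mul, ← mul_sub, ← hcM]
  have hint : ∀ {ι : Type} (s : Finset ι) (v : ι → ℝ) (k : ι → Fin n), IntervalIntegrable
      (fun t => ∑ i ∈ s, v i * (if t < c (k i) then (1 : ℝ) else 0)) volume (-M) M := by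
    intro ι s v k
    have := IntervalIntegrable.sum s (f := fun i t => v i * (if t < c (k i) then (1 : ℝ) else 0))
      (fun i _ => (intervalIntegrable_indicator_lt (-M) M (c (k i))).const_mul (v i))
    exact this.congr fun t _ => by simp
  rcases isEmpty_or_nonempty (Fin n) with hn | ⟨⟨i0⟩⟩
  · rw [univ_eq_empty, sum_empty, filter_eq_empty_iff.2, sum_empty]
    exact fun I _ h => hn.elim (j I)
  have hM0 : 0 ≤ M := (abs_nonneg _).trans (hM i0)
  have htot : ∑ i, x i = ∑ I ∈ univ.filter (fun I : Finset (Fin n) => I.Nonempty), y I :=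
    hx.2.trans (meetSum_univ y)
  rw [hsum univ x fun i => i, hsum _ y j, htot]
  refine sub_le_sub_right (intervalIntegral.integral_mono (by linarith) (hint _ _ _) (hint _ _ _)
    fun t => ?_) _
  have h := hx.1 (univ.filter fun i => t < c i)
  simp only [mul_ite, mul_one, mul_zero, ← sum_filter]
  refine h.trans (le_of_eq ?_)
  rw [meetSum, ← sum_filter, filter_filter]
  refine sum_congr (filter_congr fun I _ => ?_) fun _ _ => rfl
  constructor
  · rintro ⟨i, hi⟩
    simp only [mem_inter, mem_filter, mem_univ, true_and] at hi
    exact ⟨⟨i, hi.1⟩, hi.2.trans_le ((hj I ⟨i, hi.1⟩).2 i hi.1)⟩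
  · rintro ⟨hI, h⟩
    exact ⟨j I, by simp [(hj I hI).1, h]⟩

theorem convex_basePolytope {n : ℕ} (f : Finset (Fin n) → ℝ) : Convex ℝ (basePolytope f) := by
  intro x hx z hz a b ha hb hab
  have hS : ∀ S : Finset (Fin n), ∑ i ∈ S, (a • x + b • z) i = a * ∑ i ∈ S, x i + b * ∑ i ∈ S, z i := by
    intro S
    simp [sum_add_distrib, mul_sum]
  refine ⟨fun S => ?_, ?_⟩
  · rw [hS]
    calc a * ∑ i ∈ S, x i + b * ∑ i ∈ S, z i ≤ a * f S + b * f S :=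
          add_le_add (mul_le_mul_of_nonneg_left (hx.1 S) ha) (mul_le_mul_of_nonneg_left (hz.1 S) hb)
      _ = f S := by rw [← add_mul, hab, one_mul]
  · rw [hS, hx.2, hz.2, ← add_mul, hab, one_mul]

theorem coordSimplex_subset_basePolytope {n : ℕ} (I : Finset (Fin n)) :
    coordSimplex n I ⊆ basePolytope fun S => if (I ∩ S).Nonempty then 1 else 0 := by
  refine convexHull_min ?_ (convex_basePolytope _)
  rintro p ⟨i, hi, rfl⟩
  refine ⟨fun S => ?_, ?_⟩
  · simp only [stdVec, sum_ite_eq']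
    by_cases hS : i ∈ S
    · rw [if_pos hS, if_pos ⟨i, mem_inter.2 ⟨hi, hS⟩⟩]
    · rw [if_neg hS]
      split_ifs <;> simp
  · simp [stdVec, show I.Nonempty from ⟨i, hi⟩]

theorem isCompact_coordSimplex (n : ℕ) (I : Finset (Fin n)) : IsCompact (coordSimplex n I) := by
  refine Set.Finite.isCompact_convexHull ℝ ((I.finite_toSet.image (stdVec n)).subset ?_)
  rintro p ⟨i, hi, rfl⟩
  exact ⟨i, hi, rfl⟩

theorem isCompact_finsetSum {ι E : Type*} [AddCommMonoid E] [TopologicalSpace E] [ContinuousAdd E]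
    (s : Finset ι) (K : ι → Set E) (hK : ∀ i ∈ s, IsCompact (K i)) : IsCompact (∑ i ∈ s, K i) := by
  classical
  induction s using Finset.induction_on with
  | empty => simp
  | insert i s hi ih =>
    rw [sum_insert hi]
    exact (hK i (mem_insert_self _ _)).add (ih fun k hk => hK k (mem_insert_of_mem hk))

theorem sum_smul_coordSimplex_eq_basePolytope {n : ℕ} (y : Finset (Fin n) → ℝ)
    (hy : ∀ I, 0 ≤ y I) :
    ∑ I ∈ univ.filter (fun I : Finset (Fin n) => I.Nonempty), y I • coordSimplex n I =
      basePolytope (meetSum y) := by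
  apply Set.Subset.antisymm
  · intro x hx
    obtain ⟨g, hg, rfl⟩ := (Set.mem_finsetSum _ _ _).1 hx
    have hg' : ∀ I ∈ univ.filter (fun I : Finset (Fin n) => I.Nonempty), ∃ p ∈ basePolytope
        (fun S => if (I ∩ S).Nonempty then 1 else 0), y I • p = g I := by
      intro I hI
      obtain ⟨p, hp, hpg⟩ := hg hI
      exact ⟨p, coordSimplex_subset_basePolytope I hp, hpg⟩
    refine ⟨fun S => ?_, ?_⟩
    · simp only [Finset.sum_apply]
      rw [sum_comm, meetSum, ← sum_subset (filter_subset (fun I => I.Nonempty) univ)]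
      · refine sum_le_sum fun I hI => ?_
        obtain ⟨p, hp, hpg⟩ := hg' I hI
        rw [← hpg]
        simp only [Pi.smul_apply, smul_eq_mul, ← mul_sum]
        refine (mul_le_mul_of_nonneg_left (hp.1 S) (hy I)).trans_eq ?_
        simp
      · intro I _ hI
        rw [if_neg]
        exact fun h => hI (by simpa using h.mono inter_subset_left)
    · simp only [Finset.sum_apply]
      rw [sum_comm, meetSum_univ]
      refine sum_congr rfl fun I hI => ?_
      obtain ⟨p, hp, hpg⟩ := hg' I hI
      have h2 := hp.2
      simp only [inter_univ, if_pos (mem_filter.1 hI).2] at h2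
      rw [← hpg]
      simp only [Pi.smul_apply, smul_eq_mul, ← mul_sum, h2, mul_one]
  · intro x hx
    by_contra hxP
    have hconv : Convex ℝ (∑ I ∈ univ.filter (fun I : Finset (Fin n) => I.Nonempty),
        y I • coordSimplex n I) := convex_sum _ fun I _ => (convex_convexHull ℝ _).smul _
    have hclosed : IsClosed (∑ I ∈ univ.filter (fun I : Finset (Fin n) => I.Nonempty),
        y I • coordSimplex n I) :=
      (isCompact_finsetSum _ _ fun I _ => (isCompact_coordSimplex n I).smul (y I)).isClosed
    obtain ⟨φ, u, hφ, hux⟩ := geometric_hahn_banach_closed_point hconv hclosed hxP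
    have hmax : ∀ I : Finset (Fin n), ∃ i : Fin n, I.Nonempty →
        i ∈ I ∧ ∀ k ∈ I, φ (stdVec n k) ≤ φ (stdVec n i) := by
      intro I
      by_cases hI : I.Nonempty
      · obtain ⟨i, hi, h⟩ := I.exists_max_image (fun k => φ (stdVec n k)) hI
        exact ⟨i, fun _ => ⟨hi, h⟩⟩
      · rcases isEmpty_or_nonempty (Fin n) with hn | ⟨⟨i0⟩⟩
        · exfalso
          refine hxP ?_
          have : univ.filter (fun I : Finset (Fin n) => I.Nonempty) = ∅ :=
            filter_eq_empty_iff.2 fun J _ hJ => hn.elim hJ.choose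
          rw [this, sum_empty]
          exact Subsingleton.elim _ _
        · exact ⟨i0, fun h => absurd h hI⟩
    choose j hj using hmax
    have hle := sum_mul_le_of_mem_basePolytope y hx (fun i => φ (stdVec n i)) j hj
    have hv : ∑ I ∈ univ.filter (fun I : Finset (Fin n) => I.Nonempty), y I • stdVec n (j I) ∈
        ∑ I ∈ univ.filter (fun I : Finset (Fin n) => I.Nonempty), y I • coordSimplex n I :=
      Set.finsetSum_mem_finsetSum _ _ _ fun I hI => Set.smul_mem_smul_set
        (subset_convexHull ℝ _ ⟨j I, (hj I (mem_filter.1 hI).2).1, rfl⟩)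
    have h1 := hφ _ hv
    have h2 : φ x = ∑ i, x i * φ (stdVec n i) := by
      have h := LinearMap.pi_apply_eq_sum_univ (φ : (Fin n → ℝ) →ₗ[ℝ] ℝ) x
      simp only [ContinuousLinearMap.coe_coe, smul_eq_mul] at h
      rw [h]
      refine sum_congr rfl fun i _ => ?_
      congr 2
      ext k
      simp [stdVec, eq_comm]
    simp only [map_sum, map_smul, smul_eq_mul] at h1
    linarith

theorem vertexValue_meetSum {n : ℕ} (y : Finset (Fin n) → ℝ) (lam : Fin n → ℝ)
    (w : Equiv.Perm (Fin n)) : vertexValue (meetSum y) lam w =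
      ∑ I : Finset (Fin n), if h : I.Nonempty then lam (w (I.min' h)) * y (I.image w) else 0 := by
  have hreindex : ∀ k, meetSum y (firstValues w k) =
      ∑ I : Finset (Fin n), if ∃ i ∈ I, i.val < k then y (I.image w) else 0 := by
    intro k
    rw [meetSum, ← (Equiv.finsetCongr w).sum_comp]
    refine sum_congr rfl fun I _ => ?_
    have hI : Equiv.finsetCongr w I = I.image w := by simp [map_eq_image]
    rw [hI]
    congr 1
    simp [Finset.Nonempty, mem_firstValues]
  simp only [vertexValue, hreindex, ← sum_sub_distrib, mul_sum]
  rw [sum_comm]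
  refine sum_congr rfl fun I _ => ?_
  split_ifs with hI
  · have hlt : ∀ k, (∃ i ∈ I, i.val < k) ↔ (I.min' hI).val < k := fun k =>
      ⟨fun ⟨i, hi, hk⟩ => lt_of_le_of_lt (Fin.le_def.1 (I.min'_le i hi)) hk,
        fun h => ⟨_, I.min'_mem hI, h⟩⟩
    simp only [hlt]
    rw [sum_eq_single (I.min' hI)]
    · simp
    · intro p _ hp
      have : p.val ≠ (I.min' hI).val := fun h => hp (Fin.ext h)
      by_cases h : (I.min' hI).val < p.val
      · rw [if_pos (by omega), if_pos h, sub_self, mul_zero]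
      · rw [if_neg (by omega), if_neg h, sub_self, mul_zero]
    · simp
  · rw [not_nonempty_iff_eq_empty] at hI
    simp [hI]

end

theorem stmt19 (n : ℕ) (y : Finset (Fin (n + 1)) → ℝ) (hy : ∀ I, 0 ≤ y I)
    (lam : Fin (n + 1) → ℝ) (hlam : Function.Injective lam) :
    projVol n (∑ I ∈ Finset.univ.filter (fun I : Finset (Fin (n + 1)) => I.Nonempty),
        y I • coordSimplex (n + 1) I) =
      (1 / (Nat.factorial n : ℝ)) *
        ∑ w : Equiv.Perm (Fin (n + 1)),
          (∑ I : Finset (Fin (n + 1)),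
              if h : I.Nonempty then lam (w (I.min' h)) * y (I.image w) else 0) ^ n /
            ∏ i : Fin n, (lam (w i.castSucc) - lam (w i.succ)) := by
  simp only [sum_smul_coordSimplex_eq_basePolytope y hy, ← vertexValue_meetSum]
  simpa using projVol_basePolytope n (meetSum y) (meetSum_empty y) (meetSum_submodular y hy)
    lam hlam 0
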